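/- Let A be a (possibly infinite) geometrically fast set of positive bump functions in Homeo₊(I), equipped with a marking witnessing fastness. If s, t ∈ I both have finite history, then there is at most one word w which is locally reduced at s and satisfies sw = t. -/

import Mathlib

open Set

/-- The unit interval `[0,1]` as a type. -/
abbrev UI : Type := ↥unitInterval

/-- Bijections of the unit interval; orientation-preserving homeomorphisms are
exactly the monotone ones among these. -/
abbrev Homeo01 : Type := Equiv.Perm UI

namespace PingPong

/-- The support of `f`. -/
def supt (f : Homeo01) : Set UI := {t | f t ≠ t}

/-- `f` is an orientation-preserving homeomorphism of `[0,1]`: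
a monotone bijection of `[0,1]` (automatically a homeomorphism). -/
def IsOPH (f : Homeo01) : Prop := Monotone ⇑f

/-- A bump function: an orientation preserving homeomorphism with exactly one
orbital, i.e. whose support is nonempty and connected. -/
def IsBump (f : Homeo01) : Prop := IsOPH f ∧ IsConnected (supt f)

/-- A positive bump function. -/
def IsPosBump (f : Homeo01) : Prop := IsBump f ∧ ∀ t ∈ supt f, t < f t

/-- The source of a positive bump `a` with marker `t`. -/
def src (a : Homeo01) (t : UI) : Set UI := {s ∈ supt a | s < t}

/-- The destination of a positive bump `a` with marker `t`. -/
def dest (a : Homeo01) (t : UI) : Set UI := {s ∈ supt a | a t ≤ s}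

/-- `m` is a marking of the collection `A` of bumps. -/
def IsMarking (A : Set Homeo01) (m : Homeo01 → UI) : Prop := ∀ a ∈ A, m a ∈ supt a

/-- The feet of a marked bump: `false` gives the source, `true` the destination. -/
def foot (a : Homeo01) (t : UI) : Bool → Set UI
  | false => src a t
  | true => dest a t

/-- The feet of the marked family `(A, m)` are pairwise disjoint. -/
def FeetDisjoint (A : Set Homeo01) (m : Homeo01 → UI) : Prop :=
  ∀ a ∈ A, ∀ b ∈ A, ∀ i j : Bool, (a, i) ≠ (b, j) →
    Disjoint (foot a (m a) i) (foot b (m b) j)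

/-- A geometrically fast collection of (positive) bumps. -/
def FastBumps (A : Set Homeo01) : Prop :=
  (∀ a ∈ A, IsPosBump a) ∧ ∃ m : Homeo01 → UI, IsMarking A m ∧ FeetDisjoint A m

/-- `t` is a left transition point of `f`. -/
def IsLeftTransition (f : Homeo01) (t : UI) : Prop :=
  t ∉ supt f ∧ ∀ ε : ℝ, 0 < ε → ∃ s ∈ supt f, t < s ∧ (s : ℝ) < (t : ℝ) + ε

/-- `t` is a right transition point of `f`. -/
def IsRightTransition (f : Homeo01) (t : UI) : Prop :=
  t ∉ supt f ∧ ∀ ε : ℝ, 0 < ε → ∃ s ∈ supt f, s < t ∧ (t : ℝ) - ε < (s : ℝ)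

/-- `t` is a transition point of `f`. -/
def IsTransition (f : Homeo01) (t : UI) : Prop :=
  IsLeftTransition f t ∨ IsRightTransition f t

/-- A geometrically proper set of homeomorphisms. -/
def GeomProper (X : Set Homeo01) : Prop :=
  (∀ f ∈ X, ∀ g ∈ X, f ≠ g → ∀ t : UI, ¬(IsLeftTransition f t ∧ IsLeftTransition g t)) ∧
  (∀ f ∈ X, ∀ g ∈ X, f ≠ g → ∀ t : UI, ¬(IsRightTransition f t ∧ IsRightTransition g t))

/-- The positive bump `a` is used in `f`. -/
def UsedIn (f a : Homeo01) : Prop :=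
  IsPosBump a ∧ (Set.EqOn ⇑f ⇑a (supt a) ∨ Set.EqOn ⇑f ⇑a⁻¹ (supt a))

/-- The set of (positive) bumps used in `X`. -/
def usedBumps (X : Set Homeo01) : Set Homeo01 := {a | ∃ f ∈ X, UsedIn f a}

/-- A geometrically fast set of homeomorphisms. -/
def GeomFast (X : Set Homeo01) : Prop := GeomProper X ∧ FastBumps (usedBumps X)

/-- The set of transition points of elements of `X`. -/
def transitionPoints (X : Set Homeo01) : Set UI := {t | ∃ f ∈ X, IsTransition f t}

/-! ### Words -/

/-- A word in the alphabet `A^± = A ∪ A⁻¹`, recorded as a list of the permutations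
represented by its symbols (for a set `A` of positive bumps this is faithful,
since `A ∩ A⁻¹ = ∅`). -/
def WordOn (A : Set Homeo01) (w : List Homeo01) : Prop := ∀ x ∈ w, x ∈ A ∨ x⁻¹ ∈ A

/-- A freely reduced word: no symbol is immediately followed by its inverse. -/
def FreelyReduced (w : List Homeo01) : Prop := List.Chain' (fun a b => b ≠ a⁻¹) w

/-- The right action of a word on a point: apply the symbols from left to right. -/
def act (t : UI) (w : List Homeo01) : UI := w.foldl (fun s a => a s) t

/-- `w` is locally reduced at `t`. -/
def LocallyReducedAt (w : List Homeo01) (t : UI) : Prop :=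
  FreelyReduced w ∧ ∀ (u : List Homeo01) (a : Homeo01), u ++ [a] <+: w → a (act t u) ≠ act t u

open Classical in
/-- The source of a symbol of `A^±`: for `a ∈ A` it is `src a`, and for the
formal inverse of an element of `A` it is the destination of that element. -/
noncomputable def symSrc (A : Set Homeo01) (m : Homeo01 → UI) (b : Homeo01) : Set UI :=
  if b ∈ A then src b (m b) else dest b⁻¹ (m b⁻¹)

open Classical in
/-- The destination of a symbol of `A^±`. -/
noncomputable def symDest (A : Set Homeo01) (m : Homeo01 → UI) (b : Homeo01) : Set UI :=
  if b ∈ A then dest b (m b) else src b⁻¹ (m b⁻¹)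

/-- The source of a word: the source of its first symbol (empty for the empty word). -/
noncomputable def wordSrc (A : Set Homeo01) (m : Homeo01 → UI) : List Homeo01 → Set UI
  | [] => ∅
  | a :: _ => symSrc A m a

/-- The destination of a word: the destination of its last symbol. -/
noncomputable def wordDest (A : Set Homeo01) (m : Homeo01 → UI) (w : List Homeo01) : Set UI :=
  match w.getLast? with
  | none => ∅
  | some a => symDest A m a

/-- `J(w) = supt(a) \ src(a)` where `a` is the first symbol of `w`. -/
noncomputable def Jset (A : Set Homeo01) (m : Homeo01 → UI) : List Homeo01 → Set UI
  | [] => ∅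
  | a :: _ => supt a \ symSrc A m a

/-- `t` has trivial history: it lies in no foot of any element of `A`. -/
def TrivialHistory (A : Set Homeo01) (m : Homeo01 → UI) (t : UI) : Prop :=
  ∀ a ∈ A, t ∉ src a (m a) ∧ t ∉ dest a (m a)

/-- `x` has finite history: there is a finite bound on the lengths of `A`-words
locally reduced at `x` whose evaluation at `x` is outside their destination. -/
def FiniteHistory (A : Set Homeo01) (m : Homeo01 → UI) (x : UI) : Prop :=
  ∃ n : ℕ, ∀ w : List Homeo01, WordOn A w → LocallyReducedAt w x →
    act x w ∉ wordDest A m w → w.length ≤ n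

/-- A return word for `x`. -/
def IsReturnWord (x : UI) (w : List Homeo01) : Prop := w ≠ [] ∧ act x w = x

/-- `w` has a return prefix for `x`. -/
def HasReturnPrefix (x : UI) (w : List Homeo01) : Prop :=
  ∃ v : List Homeo01, v <+: w ∧ IsReturnWord x v

/-- The set of initial markers of the marked family `(A, m)`. -/
def initialMarkers (A : Set Homeo01) (m : Homeo01 → UI) : Set UI :=
  {t | (∃ a ∈ A, m a = t) ∧ ∀ b ∈ A, m b < t → b (m b) ≠ t}

/-- `M⟨X⟩`: the orbit of the set of initial markers of `(A, m)` under the group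
generated by `X`. -/
def MOrbit (A : Set Homeo01) (m : Homeo01 → UI) (X : Set Homeo01) : Set UI :=
  {u | ∃ t ∈ initialMarkers A m, ∃ g ∈ Subgroup.closure X, g t = u}

end PingPong
namespace PingPong

/-! ### Piecewise linear maps and Thompson's group F -/

/-- `f` is piecewise linear (finitely many affine pieces). -/
def IsPL (f : Homeo01) : Prop :=
  ∃ (n : ℕ) (t : Fin (n + 1) → ℝ), StrictMono t ∧ t 0 = 0 ∧ t (Fin.last n) = 1 ∧
    ∀ i : Fin n, ∃ c d : ℝ, ∀ s : UI,
      t i.castSucc ≤ (s : ℝ) → (s : ℝ) ≤ t i.succ → ((f s : ℝ)) = c * (s : ℝ) + d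

/-- `x` is a dyadic rational. -/
def IsDyadic (x : ℝ) : Prop := ∃ (a : ℤ) (k : ℕ), x = (a : ℝ) / 2 ^ k

/-- `f` belongs to Thompson's group `F`: an orientation-preserving piecewise linear
homeomorphism of `[0,1]` with dyadic breakpoints and slopes integer powers of `2`. -/
def InThompsonF (f : Homeo01) : Prop :=
  IsOPH f ∧
  ∃ (n : ℕ) (t : Fin (n + 1) → ℝ), StrictMono t ∧ t 0 = 0 ∧ t (Fin.last n) = 1 ∧
    (∀ i, IsDyadic (t i)) ∧
    ∀ i : Fin n, ∃ (k : ℤ) (d : ℝ), ∀ s : UI,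
      t i.castSucc ≤ (s : ℝ) → (s : ℝ) ≤ t i.succ → ((f s : ℝ)) = (2 : ℝ) ^ k * (s : ℝ) + d

/-! ### Stretched transition chains -/

/-- `a` is isolated in `A`: its support contains no transition point of an element of `A`. -/
def IsolatedIn (A : Set Homeo01) (a : Homeo01) : Prop :=
  ∀ t ∈ supt a, ∀ b ∈ A, ¬ IsTransition b t

/-- `c` (with supports `(x i, y i)`) is a stretched transition chain of `A`. -/
def IsSTC (A : Set Homeo01) (k : ℕ) (c : Fin (k + 1) → Homeo01)
    (x y : Fin (k + 1) → ℝ) : Prop :=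
  (∀ i, c i ∈ A ∧ ¬ IsolatedIn A (c i)) ∧
  (∀ i, supt (c i) = {t : UI | x i < (t : ℝ) ∧ (t : ℝ) < y i}) ∧
  (∀ i : Fin k, x i.castSucc < x i.succ ∧ x i.succ < y i.castSucc ∧ y i.castSucc < y i.succ) ∧
  (∀ i : Fin k, ∀ t : UI, x i.succ < (t : ℝ) → (t : ℝ) < y i.castSucc →
    ∀ b ∈ A, ¬ IsTransition b t)

/-- `S` is the underlying set of some stretched transition chain of `A`. -/
def ChainSet (A : Set Homeo01) (S : Set Homeo01) : Prop :=
  ∃ (k : ℕ) (c : Fin (k + 1) → Homeo01) (x y : Fin (k + 1) → ℝ),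
    IsSTC A k c x y ∧ S = Set.range c

/-- `S` is the underlying set of a maximal stretched transition chain of `A`. -/
def MaxChainSet (A : Set Homeo01) (S : Set Homeo01) : Prop :=
  ChainSet A S ∧ ∀ S' : Set Homeo01, ChainSet A S' → S ⊆ S' → S = S'

/-- The transition points of `A` lying in the support of the chain `c`. -/
def chainTrans (A : Set Homeo01) (k : ℕ) (c : Fin (k + 1) → Homeo01) : Set UI :=
  {t | (∃ i, t ∈ supt (c i)) ∧ ∃ b ∈ A, IsTransition b t}

/-- The image of `t` under the composition `∏ C = c 0 ⋯ c k`. -/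
def chainApply (k : ℕ) (c : Fin (k + 1) → Homeo01) (t : UI) : UI :=
  (List.ofFn c).foldl (fun s a => a s) t

/-! ### Dynamical diagrams -/

/-- The collection of feet of the bumps used in `X`, with marking `m`. -/
def Feet (X : Set Homeo01) (m : Homeo01 → UI) : Set (Set UI) :=
  {S | ∃ a ∈ usedBumps X, S = src a (m a) ∨ S = dest a (m a)}

/-- The signed bumps of `f`: bumps agreeing with `f` on their support. -/
def signedBumps (f : Homeo01) : Set Homeo01 :=
  {b | IsBump b ∧ Set.EqOn ⇑b ⇑f (supt b)}

open Classical in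
/-- The source of a signed bump, with respect to the marking `m` of the positive bumps. -/
noncomputable def sSrc (m : Homeo01 → UI) (b : Homeo01) : Set UI :=
  if IsPosBump b then src b (m b) else dest b⁻¹ (m b⁻¹)

open Classical in
/-- The destination of a signed bump, with respect to the marking `m` of the positive bumps. -/
noncomputable def sDest (m : Homeo01 → UI) (b : Homeo01) : Set UI :=
  if IsPosBump b then dest b (m b) else src b⁻¹ (m b⁻¹)

/-- An isomorphism of the dynamical diagrams of the marked families `(X, mX)` and
`(Y, mY)`, inducing the bijection `τ : X → Y`: an order-preserving bijection `Φ`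
between the collections of feet, together with, for each `f ∈ X`, a bijection of the
signed bumps of `f` with those of `τ f` under which `Φ` matches sources with sources
and destinations with destinations. -/
def DiagIso (X : Set Homeo01) (mX : Homeo01 → UI) (Y : Set Homeo01) (mY : Homeo01 → UI)
    (τ : Homeo01 → Homeo01) : Prop :=
  Set.BijOn τ X Y ∧
  ∃ Φ : Set UI → Set UI,
    Set.BijOn Φ (Feet X mX) (Feet Y mY) ∧
    (∀ S ∈ Feet X mX, ∀ T ∈ Feet X mX,
      (∀ s ∈ S, ∀ t ∈ T, s < t) → ∀ s ∈ Φ S, ∀ t ∈ Φ T, s < t) ∧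
    ∀ f ∈ X, ∃ β : Homeo01 → Homeo01,
      Set.BijOn β (signedBumps f) (signedBumps (τ f)) ∧
      ∀ b ∈ signedBumps f, Φ (sSrc mX b) = sSrc mY (β b) ∧ Φ (sDest mX b) = sDest mY (β b)

/-! ### Excision -/

/-- The union of the supports of the bumps of `E` used in `f`. -/
def quotSupp (f : Homeo01) (E : Set Homeo01) : Set UI :=
  {t | ∃ a ∈ E, UsedIn f a ∧ t ∈ supt a}

/-- `g = f/E`: `g` is the identity on the supports of the bumps of `E` used in `f`,
and agrees with `f` elsewhere. -/
def IsQuot (f : Homeo01) (E : Set Homeo01) (g : Homeo01) : Prop :=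
  (∀ t ∈ quotSupp f E, g t = t) ∧ ∀ t ∉ quotSupp f E, g t = f t

/-- `E` is extraneous in `X` (with respect to the marking `m`), witnessed by an
interval `J`. -/
def Extraneous (X : Set Homeo01) (m : Homeo01 → UI) (E : Set Homeo01) : Prop :=
  ∃ J : Set UI, J.OrdConnected ∧ ∃ f ∈ X,
    (∀ e ∈ E, UsedIn f e ∧ IsolatedIn (usedBumps X) e ∧ supt e ⊆ J) ∧
    (∃ a : Homeo01, UsedIn f a ∧ a ∉ E ∧ (src a (m a) ⊆ J ∨ dest a (m a) ⊆ J)) ∧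
    ∀ g ∈ X, g ≠ f → ∀ b : Homeo01, UsedIn g b →
      Disjoint (src b (m b)) J ∧ Disjoint (dest b (m b)) J

end PingPong
namespace PingPong

/-- `a` is a symbol of `A^±`. -/
def IsSymbol (A : Set Homeo01) (a : Homeo01) : Prop := a ∈ A ∨ a⁻¹ ∈ A

/-- `w` is an `A`-word each of whose symbols is applied to a point of its source
when `w` is evaluated at `x`. -/
def SourcePath (A : Set Homeo01) (m : Homeo01 → UI) : UI → List Homeo01 → Prop
  | _, [] => True
  | x, a :: w => IsSymbol A a ∧ x ∈ symSrc A m a ∧ SourcePath A m (a x) w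

/-- The formal inverse of a word. -/
def invWord (w : List Homeo01) : List Homeo01 := (w.map (·⁻¹)).reverse

lemma act_append (x : UI) (u v : List Homeo01) : act x (u ++ v) = act (act x u) v := by
  simp [act]

lemma act_cons (x : UI) (a : Homeo01) (w : List Homeo01) : act x (a :: w) = act (a x) w := rfl

lemma act_concat (x : UI) (w : List Homeo01) (a : Homeo01) :
    act x (w ++ [a]) = a (act x w) := by
  simp [act]

lemma invWord_append (u v : List Homeo01) : invWord (u ++ v) = invWord v ++ invWord u := by
  simp [invWord]

section

variable {A : Set Homeo01} {m : Homeo01 → UI}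

lemma IsSymbol.inv {a : Homeo01} (h : IsSymbol A a) : IsSymbol A a⁻¹ := by
  rcases h with h | h
  · exact Or.inr (by simpa using h)
  · exact Or.inl h

lemma mem_supt_inv {a : Homeo01} {x : UI} : x ∈ supt a⁻¹ ↔ x ∈ supt a := by
  simp only [supt, mem_ofPred_eq, ne_eq, Equiv.Perm.inv_eq_iff_eq]
  exact not_congr eq_comm

lemma apply_mem_supt {a : Homeo01} {x : UI} : a x ∈ supt a ↔ x ∈ supt a := by
  simp [supt]

lemma inv_notMem (hA : ∀ a ∈ A, IsPosBump a) {a : Homeo01} (ha : a ∈ A) : a⁻¹ ∉ A := by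
  intro h
  obtain ⟨t, ht⟩ := (hA a ha).1.2.1
  have h1 := (hA a ha).2 t ht
  have h2 := (hA _ h).2 (a t) (mem_supt_inv.2 (apply_mem_supt.2 ht))
  simp only [Equiv.Perm.coe_inv, Equiv.symm_apply_apply] at h2
  exact lt_asymm h1 h2

lemma symSrc_of_mem {a : Homeo01} (ha : a ∈ A) : symSrc A m a = src a (m a) := if_pos ha

lemma symSrc_inv_of_mem (hA : ∀ a ∈ A, IsPosBump a) {a : Homeo01} (ha : a ∈ A) :
    symSrc A m a⁻¹ = dest a (m a) := by
  simp [symSrc, inv_notMem hA ha]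

lemma symDest_eq (hA : ∀ a ∈ A, IsPosBump a) {a : Homeo01} (ha : IsSymbol A a) :
    symDest A m a = symSrc A m a⁻¹ := by
  rcases ha with h | h
  · rw [symSrc_inv_of_mem hA h, symDest, if_pos h]
  · have h' : a ∉ A := fun h2 => inv_notMem hA h2 h
    rw [symSrc_of_mem h, symDest, if_neg h']

lemma exists_foot_of_isSymbol (hA : ∀ a ∈ A, IsPosBump a) {a : Homeo01} (ha : IsSymbol A a) :
    ∃ c ∈ A, ∃ i : Bool, symSrc A m a = foot c (m c) i ∧ a = if i then c⁻¹ else c := by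
  rcases ha with h | h
  · exact ⟨a, h, false, symSrc_of_mem h, by simp⟩
  · refine ⟨a⁻¹, h, true, ?_, by simp⟩
    simpa [foot] using symSrc_inv_of_mem (m := m) hA h

lemma isSymbol_eq_of_mem_symSrc (hA : ∀ a ∈ A, IsPosBump a) (hfd : FeetDisjoint A m)
    {a b : Homeo01} (ha : IsSymbol A a) (hb : IsSymbol A b) {x : UI}
    (hxa : x ∈ symSrc A m a) (hxb : x ∈ symSrc A m b) : a = b := by
  obtain ⟨c, hc, i, hci, rfl⟩ := exists_foot_of_isSymbol (m := m) hA ha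
  obtain ⟨d, hd, j, hdj, rfl⟩ := exists_foot_of_isSymbol (m := m) hA hb
  rw [hci] at hxa
  rw [hdj] at hxb
  by_contra hne
  refine Set.disjoint_left.1 (hfd c hc d hd i j ?_) hxa hxb
  intro h
  obtain ⟨rfl, rfl⟩ := Prod.mk.inj h
  exact hne rfl

lemma symSrc_subset_supt (hA : ∀ a ∈ A, IsPosBump a) {a : Homeo01} (ha : IsSymbol A a) :
    symSrc A m a ⊆ supt a := by
  intro x hx
  rcases ha with h | h
  · rw [symSrc_of_mem h] at hx
    exact hx.1
  · have := symSrc_inv_of_mem (m := m) hA h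
    rw [inv_inv] at this
    rw [this] at hx
    exact mem_supt_inv.1 hx.1

/-- A positive bump maps a point of its support into its destination exactly when the point
lies outside its source. -/
lemma apply_mem_dest_iff (hA : ∀ a ∈ A, IsPosBump a) {a : Homeo01} (ha : a ∈ A) {x : UI}
    (hx : x ∈ supt a) : a x ∈ dest a (m a) ↔ x ∉ src a (m a) := by
  have hmono : StrictMono a := (hA a ha).1.1.strictMono_of_injective a.injective
  simp [dest, src, hx, apply_mem_supt, hmono.le_iff_le]

lemma apply_mem_symSrc_inv_iff (hA : ∀ a ∈ A, IsPosBump a) {a : Homeo01} (ha : IsSymbol A a)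
    {x : UI} (hx : a x ≠ x) : a x ∈ symSrc A m a⁻¹ ↔ x ∉ symSrc A m a := by
  rcases ha with h | h
  · rw [symSrc_inv_of_mem hA h, symSrc_of_mem h, apply_mem_dest_iff hA h hx]
  · have h1 := symSrc_inv_of_mem (m := m) hA h
    rw [inv_inv] at h1
    have h2 := apply_mem_dest_iff (m := m) hA h (x := a x)
      (mem_supt_inv.2 (apply_mem_supt.2 hx))
    rw [Equiv.Perm.coe_inv, Equiv.symm_apply_apply] at h2
    rw [h1, symSrc_of_mem h, h2, not_not]

lemma sourcePath_append {x : UI} {u v : List Homeo01} :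
    SourcePath A m x (u ++ v) ↔ SourcePath A m x u ∧ SourcePath A m (act x u) v := by
  induction u generalizing x with
  | nil => simp [SourcePath, act]
  | cons a u ih => simp [SourcePath, ih, act_cons, and_assoc]

lemma SourcePath.wordOn {x : UI} {w : List Homeo01} (h : SourcePath A m x w) : WordOn A w := by
  induction w generalizing x with
  | nil => simp [WordOn]
  | cons a w ih =>
    intro b hb
    rcases List.mem_cons.1 hb with rfl | hb
    · exact h.1
    · exact ih h.2.2 b hb

lemma SourcePath.freelyReduced (hA : ∀ a ∈ A, IsPosBump a) {x : UI} {w : List Homeo01}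
    (h : SourcePath A m x w) : FreelyReduced w := by
  induction w generalizing x with
  | nil => exact List.isChain_nil
  | cons a w ih =>
    refine List.isChain_cons.2 ⟨?_, ih h.2.2⟩
    rintro b hb rfl
    cases w with
    | nil => simp at hb
    | cons c w =>
      simp only [List.head?_cons, Option.mem_def, Option.some.injEq] at hb
      subst hb
      exact (apply_mem_symSrc_inv_iff hA h.1 (symSrc_subset_supt hA h.1 h.2.1)).1
        h.2.2.2.1 h.2.1

lemma SourcePath.locallyReducedAt (hA : ∀ a ∈ A, IsPosBump a) {x : UI} {w : List Homeo01}
    (h : SourcePath A m x w) : LocallyReducedAt w x := by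
  refine ⟨h.freelyReduced hA, ?_⟩
  rintro u a ⟨r, rfl⟩
  have h1 := (sourcePath_append.1 (sourcePath_append.1 h).1).2
  exact symSrc_subset_supt hA h1.1 h1.2.1

lemma SourcePath.act_notMem_wordDest (hA : ∀ a ∈ A, IsPosBump a) {x : UI} {w : List Homeo01}
    (h : SourcePath A m x w) : act x w ∉ wordDest A m w := by
  rcases List.eq_nil_or_concat w with rfl | ⟨u, a, rfl⟩
  · simp [wordDest]
  · rw [List.concat_eq_append] at *
    have h1 := (sourcePath_append.1 h).2
    simp only [wordDest, List.getLast?_append, List.getLast?_singleton, Option.some_or,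
      act_concat]
    rw [symDest_eq hA h1.1,
      apply_mem_symSrc_inv_iff hA h1.1 (symSrc_subset_supt hA h1.1 h1.2.1), not_not]
    exact h1.2.1

lemma FiniteHistory.exists_length_le (hA : ∀ a ∈ A, IsPosBump a) {x : UI}
    (hx : FiniteHistory A m x) : ∃ n : ℕ, ∀ w, SourcePath A m x w → w.length ≤ n := by
  obtain ⟨n, hn⟩ := hx
  exact ⟨n, fun w h => hn w h.wordOn (h.locallyReducedAt hA) (h.act_notMem_wordDest hA)⟩

lemma SourcePath.exists_length_le {x : UI} {u : List Homeo01} (hu : SourcePath A m x u)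
    (h : ∃ n : ℕ, ∀ w, SourcePath A m x w → w.length ≤ n) :
    ∃ n : ℕ, ∀ w, SourcePath A m (act x u) w → w.length ≤ n := by
  obtain ⟨n, hn⟩ := h
  refine ⟨n, fun w hw => ?_⟩
  have := hn (u ++ w) (sourcePath_append.2 ⟨hu, hw⟩)
  rw [List.length_append] at this
  omega

lemma SourcePath.eq_nil_of_act_eq {x : UI} {w : List Homeo01} (hw : SourcePath A m x w)
    (h : ∃ n : ℕ, ∀ w, SourcePath A m x w → w.length ≤ n) (hxw : act x w = x) : w = [] := by
  obtain ⟨n, hn⟩ := h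
  have key : ∀ k : ℕ, SourcePath A m x (List.replicate k w).flatten := by
    intro k
    induction k with
    | zero => simp [SourcePath]
    | succ k ih =>
      rw [List.replicate_succ, List.flatten_cons, sourcePath_append, hxw]
      exact ⟨hw, ih⟩
  have := hn _ (key (n + 1))
  by_contra hne
  have hpos := List.length_pos_iff.2 hne
  simp only [List.length_flatten, List.map_replicate, List.sum_replicate, smul_eq_mul] at this
  nlinarith

lemma SourcePath.prefix_or_prefix (hA : ∀ a ∈ A, IsPosBump a) (hfd : FeetDisjoint A m)
    {x : UI} {u v : List Homeo01} (hu : SourcePath A m x u) (hv : SourcePath A m x v) :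
    u <+: v ∨ v <+: u := by
  induction u generalizing x v with
  | nil => simp
  | cons a u ih =>
    cases v with
    | nil => simp
    | cons b v =>
      obtain rfl := isSymbol_eq_of_mem_symSrc hA hfd hu.1 hv.1 hu.2.1 hv.2.1
      simpa using ih hu.2.2 hv.2.2

lemma LocallyReducedAt.of_cons {x : UI} {a : Homeo01} {w : List Homeo01}
    (h : LocallyReducedAt (a :: w) x) :
    a x ≠ x ∧ (∀ b ∈ w.head?, b ≠ a⁻¹) ∧ LocallyReducedAt w (a x) := by
  obtain ⟨h1, h2⟩ := h
  have h1' := List.isChain_cons.1 h1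
  refine ⟨h2 [] a (by simp), h1'.1, h1'.2, fun u b hub => ?_⟩
  exact h2 (a :: u) b (by simpa using hub)

/-- A locally reduced word first follows a source path from its starting point and then
runs backwards along a source path from its end point. -/
lemma LocallyReducedAt.exists_sourcePath (hA : ∀ a ∈ A, IsPosBump a) (hfd : FeetDisjoint A m)
    {x : UI} {w : List Homeo01} (hwA : WordOn A w) (hw : LocallyReducedAt w x) :
    ∃ u v, SourcePath A m x u ∧ SourcePath A m (act x w) v ∧
      act x u = act (act x w) v ∧ w = u ++ invWord v := by
  induction w generalizing x with
  | nil => exact ⟨[], [], trivial, trivial, rfl, rfl⟩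
  | cons a w ih =>
    obtain ⟨hax, hhead, hw'⟩ := hw.of_cons
    have ha : IsSymbol A a := hwA a (by simp)
    obtain ⟨u, v, hu, hv, huv, rfl⟩ := ih (fun b hb => hwA b (by simp [hb])) hw'
    by_cases hx : x ∈ symSrc A m a
    · exact ⟨a :: u, v, ⟨ha, hx, hu⟩, hv, huv, rfl⟩
    have hax' := (apply_mem_symSrc_inv_iff hA ha hax).2 hx
    cases u with
    | nil =>
      replace huv : a x = act (act x (a :: ([] ++ invWord v))) v := huv
      refine ⟨[], v ++ [a⁻¹], trivial, sourcePath_append.2 ⟨hv, ha.inv, ?_, trivial⟩, ?_, ?_⟩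
      · rwa [← huv]
      · rw [act_concat, ← huv, Equiv.Perm.coe_inv, Equiv.symm_apply_apply]
        rfl
      · simp [invWord]
    | cons b u =>
      exact absurd (isSymbol_eq_of_mem_symSrc hA hfd hu.1 ha.inv hu.2.1 hax')
        (hhead b (by simp))

lemma FreelyReduced.eq_nil_of_append_invWord {u c v : List Homeo01}
    (h : FreelyReduced (u ++ c ++ (invWord c ++ v))) : c = [] := by
  rcases List.eq_nil_or_concat c with rfl | ⟨d, a, rfl⟩
  · rfl
  · exfalso
    have h' : List.IsChain (fun a b : Homeo01 => b ≠ a⁻¹)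
        ((u ++ d) ++ ([a, a⁻¹] ++ (invWord d ++ v))) := by
      simpa [FreelyReduced, List.Chain', invWord] using h
    have := (List.isChain_append.1 (List.isChain_append.1 h').2.1).1
    simp at this

/-- Two freely reduced words which each follow a source path from `s` and then run backwards
along a source path from `t` coincide, if the first source path from `s` is shorter. -/
lemma append_invWord_eq_of_prefix (hA : ∀ a ∈ A, IsPosBump a) (hfd : FeetDisjoint A m)
    {s t : UI} {u₁ v₁ u₂ v₂ : List Homeo01}
    (hs : ∃ n : ℕ, ∀ w, SourcePath A m s w → w.length ≤ n)
    (hu₁ : SourcePath A m s u₁) (hu₂ : SourcePath A m s u₂)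
    (hv₁ : SourcePath A m t v₁) (hv₂ : SourcePath A m t v₂)
    (h₁ : act s u₁ = act t v₁) (h₂ : act s u₂ = act t v₂)
    (hr : FreelyReduced (u₂ ++ invWord v₂)) (hu : u₁ <+: u₂) :
    u₁ ++ invWord v₁ = u₂ ++ invWord v₂ := by
  obtain ⟨c, rfl⟩ := hu
  obtain ⟨-, hc⟩ := sourcePath_append.1 hu₂
  have hs' := hu₁.exists_length_le hs
  rw [act_append] at h₂
  rcases hv₁.prefix_or_prefix hA hfd hv₂ with ⟨d, rfl⟩ | ⟨d, rfl⟩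
  · have hd := (sourcePath_append.1 hv₂).2
    rw [act_append, ← h₁] at h₂
    rw [← h₁] at hd
    have hcd : c = d := by
      rcases hc.prefix_or_prefix hA hfd hd with ⟨e, rfl⟩ | ⟨e, rfl⟩
      · rw [act_append] at h₂
        have := (sourcePath_append.1 hd).2.eq_nil_of_act_eq (hc.exists_length_le hs') h₂.symm
        simp [this]
      · rw [act_append] at h₂
        have := (sourcePath_append.1 hc).2.eq_nil_of_act_eq (hd.exists_length_le hs') h₂
        simp [this]
    subst hcd
    rw [invWord_append] at hr
    simp [hr.eq_nil_of_append_invWord]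
  · have hd := (sourcePath_append.1 hv₁).2
    rw [act_append, ← h₂] at h₁
    rw [← h₂] at hd
    have hcd := SourcePath.eq_nil_of_act_eq (sourcePath_append.2 ⟨hc, hd⟩) hs'
      (by rw [act_append, ← h₁])
    obtain ⟨rfl, rfl⟩ := List.append_eq_nil_iff.1 hcd
    simp

end

/-- **Lemma (TreeAction).** For a geometrically fast marked set `A` of positive
bumps: if `s, t` both have finite history, there is at most one `A`-word locally
reduced at `s` carrying `s` to `t`. -/
theorem tree_action (A : Set Homeo01) (m : Homeo01 → UI)
    (hA : ∀ a ∈ A, IsPosBump a) (hm : IsMarking A m) (hfd : FeetDisjoint A m)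
    (s t : UI) (hs : FiniteHistory A m s) (ht : FiniteHistory A m t) :
    ∀ w₁ w₂ : List Homeo01, WordOn A w₁ → WordOn A w₂ →
      LocallyReducedAt w₁ s → LocallyReducedAt w₂ s →
      act s w₁ = t → act s w₂ = t → w₁ = w₂ := by
  intro w₁ w₂ hw₁ hw₂ hl₁ hl₂ e₁ e₂
  obtain ⟨u₁, v₁, hu₁, hv₁, h₁, d₁⟩ := hl₁.exists_sourcePath hA hfd hw₁
  obtain ⟨u₂, v₂, hu₂, hv₂, h₂, d₂⟩ := hl₂.exists_sourcePath hA hfd hw₂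
  rw [e₁] at hv₁ h₁
  rw [e₂] at hv₂ h₂
  have hs' := hs.exists_length_le hA
  have hr₁ := hl₁.1
  have hr₂ := hl₂.1
  rw [d₁] at hr₁ ⊢
  rw [d₂] at hr₂ ⊢
  rcases hu₁.prefix_or_prefix hA hfd hu₂ with hu | hu
  · exact append_invWord_eq_of_prefix hA hfd hs' hu₁ hu₂ hv₁ hv₂ h₁ h₂ hr₂ hu
  · exact (append_invWord_eq_of_prefix hA hfd hs' hu₂ hu₁ hv₂ hv₁ h₂ h₁ hr₁ hu).symm

end PingPong
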